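/- For every u ∈ S_n, if x ∈ Y_{≥u} and y ∈ Y, then the product x·y belongs to Y_{≥u}; that is, Y_{≥u}·Y ⊆ Y_{≥u}. -/

import Mathlib

open scoped Classical

namespace BruhatTNN

abbrev Mat (n : ℕ) := Matrix (Fin n) (Fin n) ℝ

/-- `x` is upper unitriangular. -/
def upperUni {n : ℕ} (x : Mat n) : Prop :=
  (∀ i, x i i = 1) ∧ ∀ i j : Fin n, j < i → x i j = 0

/-- `x` is lower unitriangular. -/
def lowerUni {n : ℕ} (x : Mat n) : Prop :=
  (∀ i, x i i = 1) ∧ ∀ i j : Fin n, i < j → x i j = 0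

/-- `x` is invertible upper triangular (`x ∈ B`). -/
def upperTriInv {n : ℕ} (x : Mat n) : Prop :=
  IsUnit x.det ∧ ∀ i j : Fin n, j < i → x i j = 0

/-- `x` is invertible lower triangular (`x ∈ B_-`). -/
def lowerTriInv {n : ℕ} (x : Mat n) : Prop :=
  IsUnit x.det ∧ ∀ i j : Fin n, i < j → x i j = 0

/-- `x` is invertible diagonal (`x ∈ H`). -/
def diagInv {n : ℕ} (x : Mat n) : Prop :=
  IsUnit x.det ∧ ∀ i j : Fin n, i ≠ j → x i j = 0

/-- `x` admits a Gaussian decomposition (`x ∈ G_0`). -/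
def hasGauss {n : ℕ} (x : Mat n) : Prop :=
  ∃ a d b : Mat n, lowerUni a ∧ diagInv d ∧ upperUni b ∧ x = a * d * b

/-- The factor `[x]_-` of the Gaussian decomposition (junk value `1` if none exists). -/
noncomputable def gaussMinus {n : ℕ} (x : Mat n) : Mat n :=
  if h : hasGauss x then h.choose else 1

/-- The factor `[x]_0` of the Gaussian decomposition (junk value `1` if none exists). -/
noncomputable def gaussDiag {n : ℕ} (x : Mat n) : Mat n :=
  if h : hasGauss x then h.choose_spec.choose else 1

/-- The factor `[x]_+` of the Gaussian decomposition (junk value `1` if none exists). -/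
noncomputable def gaussPlus {n : ℕ} (x : Mat n) : Mat n :=
  if h : hasGauss x then h.choose_spec.choose_spec.choose else 1

/-- The permutation matrix of `w`, with entry `1` in position `(w j, j)`. -/
def permMat {n : ℕ} (w : Equiv.Perm (Fin n)) : Mat n :=
  Matrix.of fun i j => if i = w j then (1 : ℝ) else 0

/-- The minor of `x` with row set `I` and column set `J` (taken in increasing order). -/
def minorOf {n : ℕ} (x : Mat n) (k : ℕ) (I J : Finset (Fin n))
    (hI : I.card = k) (hJ : J.card = k) : ℝ :=
  Matrix.det (Matrix.of fun a b : Fin k => x (I.orderEmbOfFin hI a) (J.orderEmbOfFin hJ b))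

/-- `x` is totally nonnegative: all its minors are nonnegative. -/
def totNonneg {n : ℕ} (x : Mat n) : Prop :=
  ∀ (k : ℕ) (I J : Finset (Fin n)) (hI : I.card = k) (hJ : J.card = k),
    0 ≤ minorOf x k I J hI hJ

/-- The Bruhat order on the symmetric group. -/
def bruhatLE {n : ℕ} (u v : Equiv.Perm (Fin n)) : Prop :=
  ∀ i j : Fin n,
    (Finset.univ.filter fun k : Fin n => k ≤ i ∧ j ≤ u k).card ≤
    (Finset.univ.filter fun k : Fin n => k ≤ i ∧ j ≤ v k).card

/-- The double coset `B_- w B_-`. -/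
def doubleCosetBm {n : ℕ} (w : Equiv.Perm (Fin n)) : Set (Mat n) :=
  {x | ∃ b₁ b₂ : Mat n, lowerTriInv b₁ ∧ lowerTriInv b₂ ∧ x = b₁ * permMat w * b₂}

/-- `N^w = B_- w B_- ∩ N`. -/
def Ncell {n : ℕ} (w : Equiv.Perm (Fin n)) : Set (Mat n) :=
  {x | upperUni x ∧ x ∈ doubleCosetBm w}

/-- `N_-(w) = w⁻¹ N w ∩ N_-`. -/
def Nminus {n : ℕ} (w : Equiv.Perm (Fin n)) : Set (Mat n) :=
  {x | lowerUni x ∧ ∃ y : Mat n, upperUni y ∧ x = permMat w⁻¹ * y * permMat w}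

/-- `N(w) = w⁻¹ N w ∩ N`. -/
def Ngrp {n : ℕ} (w : Equiv.Perm (Fin n)) : Set (Mat n) :=
  {x | upperUni x ∧ ∃ y : Mat n, upperUni y ∧ x = permMat w⁻¹ * y * permMat w}

/-- The totally positive cell `Y°_w = Y ∩ B_- w B_-`. -/
def Ycirc {n : ℕ} (w : Equiv.Perm (Fin n)) : Set (Mat n) :=
  {x | upperUni x ∧ totNonneg x ∧ x ∈ doubleCosetBm w}

/-- `Y_{≥ u} = ⋃_{v ≥ u} Y°_v`. -/
def Yge {n : ℕ} (u : Equiv.Perm (Fin n)) : Set (Mat n) :=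
  {x | ∃ v, bruhatLE u v ∧ x ∈ Ycirc v}

/-- `A = u⁻¹ [x u⁻¹]_+ u`. -/
noncomputable def Amat {n : ℕ} (u : Equiv.Perm (Fin n)) (x : Mat n) : Mat n :=
  permMat u⁻¹ * gaussPlus (x * permMat u⁻¹) * permMat u

/-- The projection `π_u(x) = [u [u⁻¹ [x u⁻¹]_+ u]_-]_+`. -/
noncomputable def piMap {n : ℕ} (u : Equiv.Perm (Fin n)) (x : Mat n) : Mat n :=
  gaussPlus (permMat u * gaussMinus (Amat u x))

/-- `str(M)`: the sum of the matrix entries immediately above the main diagonal. -/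
def strAbove {n : ℕ} (M : Mat n) : ℝ :=
  ∑ p : Fin n × Fin n, if (p.1 : ℕ) + 1 = (p.2 : ℕ) then M p.1 p.2 else 0

/-- The number of inversions (the length) of a permutation. -/
def invNum {n : ℕ} (w : Equiv.Perm (Fin n)) : ℕ :=
  (Finset.univ.filter fun p : Fin n × Fin n => p.1 < p.2 ∧ w p.2 < w p.1).card

/-- The symmetrised Cauchy–Binet formula: the determinant of a product is a sum over all maps
between the index sets. -/
theorem factorial_mul_det_mul {k n : ℕ} (A : Matrix (Fin k) (Fin n) ℝ)
    (B : Matrix (Fin n) (Fin k) ℝ) :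
    (k.factorial : ℝ) * (A * B).det =
      ∑ p : Fin k → Fin n, (A.submatrix id p).det * (B.submatrix p id).det := by
  have expand : (A * B).det =
      ∑ p : Fin k → Fin n, (A.submatrix id p).det * ∏ i, B (p i) i := by
    simp only [Matrix.det_apply', Matrix.mul_apply, Finset.prod_univ_sum, Finset.mul_sum,
      Fintype.piFinset_univ, Finset.sum_mul]
    rw [Finset.sum_comm]
    refine Finset.sum_congr rfl fun p _ => Finset.sum_congr rfl fun σ _ => ?_
    simp [Finset.prod_mul_distrib, mul_assoc]
  have perm_expand (σ : Equiv.Perm (Fin k)) : (A * B).det =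
      ∑ p : Fin k → Fin n, (A.submatrix id p).det *
        ((Equiv.Perm.sign σ : ℤ) * ∏ i, B (p (σ i)) i) := by
    rw [expand, ← (Equiv.arrowCongr σ (Equiv.refl (Fin n))).symm.sum_comp]
    refine Finset.sum_congr rfl fun p _ => ?_
    have h := Matrix.det_permute' σ (A.submatrix id p)
    rw [Matrix.submatrix_submatrix] at h
    have hp : (Equiv.arrowCongr σ (Equiv.refl (Fin n))).symm p = p ∘ σ := by
      ext i; simp [Equiv.arrowCongr]
    rw [hp]
    simp only [Function.comp_apply]
    rw [show (A.submatrix id (p ∘ σ)).det = _ from h]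
    ring
  have total : ∑ _σ : Equiv.Perm (Fin k), (A * B).det = (k.factorial : ℝ) * (A * B).det := by
    simp [Fintype.card_perm]
  rw [← total, Finset.sum_congr rfl fun σ _ => perm_expand σ, Finset.sum_comm]
  refine Finset.sum_congr rfl fun p _ => ?_
  rw [← Finset.mul_sum]
  congr 1
  rw [Matrix.det_apply']
  rfl

theorem factorial_mul_det_submatrix_mul {k n : ℕ} (A B : Mat n) (f g : Fin k → Fin n) :
    (k.factorial : ℝ) * ((A * B).submatrix f g).det =
      ∑ p : Fin k → Fin n, (A.submatrix f p).det * (B.submatrix p g).det :=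
  factorial_mul_det_mul (A.submatrix f id) (B.submatrix id g)

theorem exists_minor_ne_zero_of_mul {k n : ℕ} {A B : Mat n} {f g : Fin k → Fin n}
    (h : ((A * B).submatrix f g).det ≠ 0) :
    ∃ p : Fin k → Fin n, (A.submatrix f p).det ≠ 0 ∧ (B.submatrix p g).det ≠ 0 := by
  have hk : (k.factorial : ℝ) ≠ 0 := by exact_mod_cast k.factorial_ne_zero
  obtain ⟨p, -, hp⟩ := Finset.exists_ne_zero_of_sum_ne_zero
    (factorial_mul_det_submatrix_mul A B f g ▸ mul_ne_zero hk h)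
  exact ⟨p, left_ne_zero_of_mul hp, right_ne_zero_of_mul hp⟩

/-- `A` has a nonvanishing minor of size `k` among the rows of index `< a` and the columns of
index `≥ b`. -/
def HasMinor {n : ℕ} (A : Mat n) (a b k : ℕ) : Prop :=
  ∃ f g : Fin k → Fin n, (∀ i, (f i : ℕ) < a) ∧ (∀ i, b ≤ (g i : ℕ)) ∧
    (A.submatrix f g).det ≠ 0

theorem HasMinor.of_lower_mul {n a b k : ℕ} {L A : Mat n} (hL : ∀ i j : Fin n, i < j → L i j = 0)
    (h : HasMinor (L * A) a b k) : HasMinor A a b k := by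
  obtain ⟨f, g, hf, hg, hd⟩ := h
  obtain ⟨p, hp, hp'⟩ := exists_minor_ne_zero_of_mul hd
  refine ⟨p, g, fun i => ?_, hg, hp'⟩
  by_contra! hi
  refine hp (Matrix.det_eq_zero_of_column_eq_zero i fun r => hL _ _ ?_)
  exact Fin.lt_def.2 ((hf r).trans_le hi)

theorem HasMinor.of_mul_lower {n a b k : ℕ} {L A : Mat n} (hL : ∀ i j : Fin n, i < j → L i j = 0)
    (h : HasMinor (A * L) a b k) : HasMinor A a b k := by
  obtain ⟨f, g, hf, hg, hd⟩ := h
  obtain ⟨p, hp, hp'⟩ := exists_minor_ne_zero_of_mul hd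
  refine ⟨f, p, hf, fun i => ?_, hp⟩
  by_contra! hi
  refine hp' (Matrix.det_eq_zero_of_row_eq_zero i fun r => hL _ _ ?_)
  exact Fin.lt_def.2 (hi.trans_le (hg r))

theorem HasMinor.card_le {n a b k : ℕ} {w : Equiv.Perm (Fin n)}
    (h : HasMinor (permMat w) a b k) :
    k ≤ (Finset.univ.filter fun c : Fin n => b ≤ (c : ℕ) ∧ (w c : ℕ) < a).card := by
  obtain ⟨f, g, hf, hg, hd⟩ := h
  have hinj : Function.Injective g := by
    intro i j hij
    by_contra hne
    exact hd (Matrix.det_zero_of_column_eq hne fun r => by simp [hij])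
  rw [Matrix.det_apply'] at hd
  obtain ⟨σ, -, hσ⟩ := Finset.exists_ne_zero_of_sum_ne_zero hd
  have hσ' := Finset.prod_ne_zero_iff.1 (right_ne_zero_of_mul hσ)
  calc k = (Finset.univ.image g).card := by
        rw [Finset.card_image_of_injective _ hinj, Finset.card_univ, Fintype.card_fin]
    _ ≤ _ := Finset.card_le_card fun c hc => by
        obtain ⟨i, -, rfl⟩ := Finset.mem_image.1 hc
        have h1 : f (σ i) = w (g i) := by
          by_contra hne
          exact hσ' i (Finset.mem_univ i) (by simp [permMat, hne])
        exact Finset.mem_filter.2 ⟨Finset.mem_univ _, hg i, h1 ▸ hf (σ i)⟩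

theorem hasMinor_permMat {n : ℕ} (w : Equiv.Perm (Fin n)) (a b : ℕ) :
    HasMinor (permMat w) a b
      (Finset.univ.filter fun c : Fin n => b ≤ (c : ℕ) ∧ (w c : ℕ) < a).card := by
  set s := Finset.univ.filter fun c : Fin n => b ≤ (c : ℕ) ∧ (w c : ℕ) < a with hs
  have hmem (i) : b ≤ (s.orderEmbOfFin rfl i : ℕ) ∧ (w (s.orderEmbOfFin rfl i) : ℕ) < a :=
    (Finset.mem_filter.1 (s.orderEmbOfFin_mem rfl i)).2
  refine ⟨fun i => w (s.orderEmbOfFin rfl i), s.orderEmbOfFin rfl, fun i => (hmem i).2,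
    fun i => (hmem i).1, ?_⟩
  have : (permMat w).submatrix (fun i => w (s.orderEmbOfFin rfl i)) (s.orderEmbOfFin rfl) = 1 := by
    ext i j
    simp [permMat, Matrix.one_apply]
  rw [this, Matrix.det_one]
  exact one_ne_zero

/-- A double coset representative determines the sizes of the nonvanishing northeast minors. -/
theorem hasMinor_permMat_of_mem {n a b k : ℕ} {w : Equiv.Perm (Fin n)} {x : Mat n}
    (hx : x ∈ doubleCosetBm w) (h : HasMinor x a b k) : HasMinor (permMat w) a b k := by
  obtain ⟨b₁, b₂, h₁, h₂, rfl⟩ := hx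
  exact (h.of_mul_lower h₂.2).of_lower_mul h₁.2

theorem lowerTriInv.inv {n : ℕ} {L : Mat n} (hL : lowerTriInv L) : lowerTriInv L⁻¹ := by
  have := L.invertibleOfIsUnitDet hL.1
  refine ⟨Matrix.isUnit_nonsing_inv_det L hL.1, fun i j hij => ?_⟩
  have hbt : L.BlockTriangular (OrderDual.toDual : Fin n → (Fin n)ᵒᵈ) := fun i j h => hL.2 i j h
  exact Matrix.blockTriangular_inv_of_blockTriangular hbt hij

theorem lowerTriInv.mul {n : ℕ} {L M : Mat n} (hL : lowerTriInv L) (hM : lowerTriInv M) :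
    lowerTriInv (L * M) := by
  refine ⟨by rw [Matrix.det_mul]; exact hL.1.mul hM.1, fun i j hij => ?_⟩
  have hbt {A : Mat n} (hA : lowerTriInv A) :
      A.BlockTriangular (OrderDual.toDual : Fin n → (Fin n)ᵒᵈ) := fun i j h => hA.2 i j h
  exact (hbt hL).mul (hbt hM) hij

theorem HasMinor.of_mem {n a b k : ℕ} {w : Equiv.Perm (Fin n)} {x : Mat n}
    (hx : x ∈ doubleCosetBm w) (h : HasMinor (permMat w) a b k) : HasMinor x a b k := by
  obtain ⟨b₁, b₂, h₁, h₂, rfl⟩ := hx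
  have e : permMat w = b₁⁻¹ * ((b₁ * permMat w * b₂) * b₂⁻¹) := by
    rw [Matrix.mul_nonsing_inv_cancel_right _ _ h₂.1, Matrix.nonsing_inv_mul_cancel_left _ _ h₁.1]
  rw [e] at h
  exact (h.of_lower_mul h₁.inv.2).of_mul_lower h₂.inv.2

/-- The two complementary corner counts of a permutation differ by a quantity independent of it. -/
theorem card_corner_add {n : ℕ} (u : Equiv.Perm (Fin n)) (i j : Fin n) :
    (Finset.univ.filter fun k : Fin n => k ≤ i ∧ j ≤ u k).card + j =
      (Finset.univ.filter fun c : Fin n => (i : ℕ) + 1 ≤ (c : ℕ) ∧ (u c : ℕ) < j).card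
        + (i + 1) := by
  have h1 := Finset.card_filter_add_card_filter_not (s := Finset.univ.filter fun k : Fin n => k ≤ i)
    (fun k => j ≤ u k)
  have h2 := Finset.card_filter_add_card_filter_not (s := Finset.univ.filter fun k : Fin n => u k < j)
    (fun k => k ≤ i)
  simp only [Finset.filter_filter] at h1 h2
  have h3 : (Finset.univ.filter fun k : Fin n => k ≤ i).card = i + 1 := by
    rw [← Fin.card_Iic]
    congr 1
    ext; simp
  have h4 : (Finset.univ.filter fun k : Fin n => u k < j).card = j := by
    have : (Finset.univ.filter fun k : Fin n => k < j).card = j := by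
      rw [← Fin.card_Iio]
      congr 1
      ext; simp
    rw [← this]
    exact Finset.card_equiv u (by simp)
  have h5 : (Finset.univ.filter fun k : Fin n => k ≤ i ∧ ¬ j ≤ u k) =
      Finset.univ.filter fun k : Fin n => u k < j ∧ k ≤ i := by
    ext k; simp [and_comm]
  have h6 : (Finset.univ.filter fun k : Fin n => u k < j ∧ ¬ k ≤ i) =
      Finset.univ.filter fun c : Fin n => (i : ℕ) + 1 ≤ (c : ℕ) ∧ (u c : ℕ) < j := by
    ext k
    simp only [Finset.mem_filter, Finset.mem_univ, true_and, not_le, Fin.lt_def, Nat.succ_le_iff]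
    exact and_comm
  rw [h5] at h1
  rw [h6] at h2
  omega

theorem bruhatLE_of_hasMinor {n : ℕ} {v w : Equiv.Perm (Fin n)}
    (h : ∀ a b k, HasMinor (permMat v) a b k → HasMinor (permMat w) a b k) : bruhatLE v w := by
  intro i j
  have h1 := (h _ _ _ (hasMinor_permMat v j (i + 1))).card_le
  have h2 := card_corner_add v i j
  have h3 := card_corner_add w i j
  omega

theorem bruhatLE.trans {n : ℕ} {u v w : Equiv.Perm (Fin n)} (h₁ : bruhatLE u v)
    (h₂ : bruhatLE v w) : bruhatLE u w :=
  fun i j => (h₁ i j).trans (h₂ i j)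

theorem totNonneg.det_nonneg {n k : ℕ} {x : Mat n} (hx : totNonneg x) {f g : Fin k → Fin n}
    (hf : StrictMono f) (hg : StrictMono g) : 0 ≤ (x.submatrix f g).det := by
  have hcard {h : Fin k → Fin n} (hh : StrictMono h) : (Finset.univ.image h).card = k := by
    rw [Finset.card_image_of_injective _ hh.injective, Finset.card_univ, Fintype.card_fin]
  have hemb {h : Fin k → Fin n} (hh : StrictMono h) :
      h = (Finset.univ.image h).orderEmbOfFin (hcard hh) :=
    Finset.orderEmbOfFin_unique (hcard hh)
      (fun i => Finset.mem_image_of_mem h (Finset.mem_univ i)) hh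
  have h := hx k _ _ (hcard hf) (hcard hg)
  rw [minorOf, ← hemb hf, ← hemb hg] at h
  exact h

theorem det_submatrix_comp_perm_left {n k : ℕ} (x : Mat n) (f g : Fin k → Fin n)
    (σ : Equiv.Perm (Fin k)) :
    (x.submatrix (f ∘ σ) g).det = (Equiv.Perm.sign σ : ℤ) * (x.submatrix f g).det :=
  Matrix.det_permute σ (x.submatrix f g)

theorem det_submatrix_comp_perm_right {n k : ℕ} (x : Mat n) (f g : Fin k → Fin n)
    (σ : Equiv.Perm (Fin k)) :
    (x.submatrix f (g ∘ σ)).det = (Equiv.Perm.sign σ : ℤ) * (x.submatrix f g).det :=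
  Matrix.det_permute' σ (x.submatrix f g)

theorem sign_mul_sign_real {k : ℕ} (σ : Equiv.Perm (Fin k)) :
    ((Equiv.Perm.sign σ : ℤ) : ℝ) * ((Equiv.Perm.sign σ : ℤ) : ℝ) = 1 := by
  rcases Int.units_eq_one_or (Equiv.Perm.sign σ) with h | h <;> simp [h]

theorem strictMono_comp_sort {n k : ℕ} {f : Fin k → Fin n} (hf : Function.Injective f) :
    StrictMono (f ∘ Tuple.sort f) :=
  (Tuple.monotone_sort f).strictMono_of_injective (hf.comp (Tuple.sort f).injective)

theorem injective_of_det_submatrix_ne_zero {n k : ℕ} {x : Mat n} {f g : Fin k → Fin n}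
    (h : (x.submatrix f g).det ≠ 0) : Function.Injective f ∧ Function.Injective g := by
  constructor <;> intro i j hij <;> by_contra hne
  · exact h (Matrix.det_zero_of_row_eq hne (by ext r; simp [hij]))
  · exact h (Matrix.det_zero_of_column_eq hne fun r => by simp [hij])

theorem cauchyBinet_term_nonneg {n k : ℕ} {x y : Mat n} (hx : totNonneg x) (hy : totNonneg y)
    {f g : Fin k → Fin n} (hf : StrictMono f) (hg : StrictMono g) (p : Fin k → Fin n) :
    0 ≤ (x.submatrix f p).det * (y.submatrix p g).det := by
  by_cases h : (x.submatrix f p).det = 0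
  · simp [h]
  have hp := strictMono_comp_sort (injective_of_det_submatrix_ne_zero h).2
  have h1 := mul_nonneg (hx.det_nonneg hf hp) (hy.det_nonneg hp hg)
  rw [det_submatrix_comp_perm_right, det_submatrix_comp_perm_left, mul_mul_mul_comm,
    sign_mul_sign_real, one_mul] at h1
  exact h1

theorem totNonneg.mul {n : ℕ} {x y : Mat n} (hx : totNonneg x) (hy : totNonneg y) :
    totNonneg (x * y) := by
  intro k I J hI hJ
  have hk : (0 : ℝ) < k.factorial := by exact_mod_cast k.factorial_pos
  refine (mul_nonneg_iff_of_pos_left hk).1 ?_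
  have h := factorial_mul_det_submatrix_mul x y (I.orderEmbOfFin hI) (J.orderEmbOfFin hJ)
  refine le_of_le_of_eq ?_ h.symm
  exact Finset.sum_nonneg fun p _ => cauchyBinet_term_nonneg hx hy
    (I.orderEmbOfFin hI).strictMono (J.orderEmbOfFin hJ).strictMono p

theorem upperUni.det_submatrix {n k : ℕ} {y : Mat n} (hy : upperUni y) {g : Fin k → Fin n}
    (hg : StrictMono g) : (y.submatrix g g).det = 1 := by
  rw [Matrix.det_of_isUpperTriangular]
  · simp [hy.1]
  · intro i j hij
    exact hy.2 _ _ (hg hij)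

theorem HasMinor.mul_right {n a b k : ℕ} {x y : Mat n} (hx : totNonneg x) (hy : totNonneg y)
    (hyN : upperUni y) (h : HasMinor x a b k) : HasMinor (x * y) a b k := by
  obtain ⟨f, g, hf, hg, hd⟩ := h
  obtain ⟨hfi, hgi⟩ := injective_of_det_submatrix_ne_zero hd
  have hf' := strictMono_comp_sort hfi
  have hg' := strictMono_comp_sort hgi
  refine ⟨f ∘ Tuple.sort f, g ∘ Tuple.sort g, fun i => hf _, fun i => hg _, ?_⟩
  have hpos : 0 < (x.submatrix (f ∘ Tuple.sort f) (g ∘ Tuple.sort g)).det := by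
    refine (hx.det_nonneg hf' hg').lt_of_ne' ?_
    rw [det_submatrix_comp_perm_left, det_submatrix_comp_perm_right]
    exact mul_ne_zero (left_ne_zero_of_mul_eq_one (sign_mul_sign_real _))
      (mul_ne_zero (left_ne_zero_of_mul_eq_one (sign_mul_sign_real _)) hd)
  have hsum := Finset.single_le_sum
    (fun p _ => cauchyBinet_term_nonneg hx hy hf' hg' p) (Finset.mem_univ (g ∘ Tuple.sort g))
  rw [hyN.det_submatrix hg', mul_one, ← factorial_mul_det_submatrix_mul] at hsum
  exact right_ne_zero_of_mul (hpos.trans_le hsum).ne'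

theorem upperUni.mul {n : ℕ} {x y : Mat n} (hx : upperUni x) (hy : upperUni y) :
    upperUni (x * y) := by
  constructor
  · intro i
    rw [Matrix.mul_apply, Finset.sum_eq_single i, hx.1, hy.1, one_mul]
    · intro j _ hj
      rcases lt_or_gt_of_ne hj with h | h
      · rw [hx.2 i j h, zero_mul]
      · rw [hy.2 j i h, mul_zero]
    · simp
  · intro i j hij
    rw [Matrix.mul_apply]
    refine Finset.sum_eq_zero fun c _ => ?_
    rcases lt_or_ge c i with h | h
    · rw [hx.2 i c h, zero_mul]
    · rw [hy.2 c j (hij.trans_le h), mul_zero]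

theorem upperUni.isUnit_det {n : ℕ} {x : Mat n} (hx : upperUni x) : IsUnit x.det := by
  have h := hx.det_submatrix (g := id) strictMono_id
  rw [Matrix.submatrix_id_id] at h
  simp [h]

/-- The entry at `(i, j)` is nonzero and is alone in its row and its column. -/
def IsolatedEntry {n : ℕ} (M : Mat n) (i j : Fin n) : Prop :=
  M i j ≠ 0 ∧ (∀ c, c ≠ j → M i c = 0) ∧ ∀ r, r ≠ i → M r j = 0

theorem lowerTriInv_one {n : ℕ} : lowerTriInv (1 : Mat n) :=
  ⟨by simp, fun _ _ h => Matrix.one_apply_ne h.ne⟩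

theorem lowerTriInv_of_lowerUni {n : ℕ} {L : Mat n} (h : lowerUni L) : lowerTriInv L := by
  refine ⟨?_, h.2⟩
  rw [Matrix.det_of_isLowerTriangular L fun i j hij => h.2 i j hij]
  simp [h.1]

/-- One step of elimination: clear the row and the column of the last nonzero entry of row `i`. -/
theorem exists_eliminate {n : ℕ} {M : Mat n} {i j : Fin n} (hne : M i j ≠ 0)
    (hrow : ∀ c, j < c → M i c = 0) (hcol : ∀ r, r < i → M r j = 0) :
    ∃ L R : Mat n, lowerTriInv L ∧ lowerTriInv R ∧ IsolatedEntry (L * M * R) i j ∧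
      ∀ r s, r < i → IsolatedEntry M r s → IsolatedEntry (L * M * R) r s := by
  let L : Mat n := Matrix.of fun r c => if r = c then 1 else if c = i then -(M r j / M i j) else 0
  let R : Mat n := Matrix.of fun r c => if r = c then 1 else if r = j then -(M i c / M i j) else 0
  have hMR (r c) : (M * R) r c = if c = j then M r j else M r c - M r j * (M i c / M i j) := by
    have : ∀ d, M r d * R d c = (if d = c then M r d else 0) +
        (if d = j then (if j = c then 0 else -(M r j * (M i c / M i j))) else 0) := by
      intro d
      simp only [R, Matrix.of_apply]
      split_ifs <;> simp_all
    rw [Matrix.mul_apply, Finset.sum_congr rfl fun d _ => this d, Finset.sum_add_distrib,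
      Finset.sum_ite_eq', Finset.sum_ite_eq']
    by_cases h : c = j
    · simp [h]
    · simp [h, Ne.symm h, sub_eq_add_neg]
  have hLA (A : Mat n) (r c) : (L * A) r c = if r = i then A i c else A r c - M r j / M i j * A i c := by
    have : ∀ d, L r d * A d c = (if r = d then A d c else 0) +
        (if d = i then (if r = i then 0 else -(M r j / M i j * A i c)) else 0) := by
      intro d
      simp only [L, Matrix.of_apply]
      split_ifs <;> simp_all
    rw [Matrix.mul_apply, Finset.sum_congr rfl fun d _ => this d, Finset.sum_add_distrib,
      Finset.sum_ite_eq, Finset.sum_ite_eq']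
    by_cases h : r = i
    · simp [h]
    · simp [h, sub_eq_add_neg]
  have key (r c) : (L * M * R) r c =
      if r = i then (if c = j then M i j else 0)
      else if c = j then 0 else M r c - M r j * M i c / M i j := by
    rw [Matrix.mul_assoc, hLA, hMR, hMR]
    split_ifs <;> simp_all <;> field_simp <;> ring
  refine ⟨L, R, lowerTriInv_of_lowerUni ⟨by simp [L], fun r c hrc => ?_⟩,
    lowerTriInv_of_lowerUni ⟨by simp [R], fun r c hrc => ?_⟩, ⟨?_, ?_, ?_⟩, ?_⟩
  · by_cases hc : c = i
    · subst hc; simp [L, hrc.ne, hcol r hrc]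
    · simp [L, hrc.ne, hc]
  · by_cases hr : r = j
    · subst hr; simp [R, hrc.ne, hrow c hrc]
    · simp [R, hrc.ne, hr]
  · simpa [key] using hne
  · intro c hc; simp [key, hc]
  · intro r hr; simp [key, hr]
  · rintro r s hr ⟨h1, h2, h3⟩
    have hrj := hcol r hr
    have hsj : s ≠ j := by rintro rfl; exact h1 hrj
    have his := h3 i hr.ne'
    refine ⟨?_, fun c hc => ?_, fun t ht => ?_⟩
    · simpa [key, hr.ne, hsj, hrj] using h1
    · simp [key, hr.ne, hrj, h2 c hc]
    · simp [key, hsj, his, h3 t ht]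

theorem exists_isolated_rows {n : ℕ} {M : Mat n} (hM : IsUnit M.det) (k : ℕ) :
    ∃ L R : Mat n, lowerTriInv L ∧ lowerTriInv R ∧
      ∀ i : Fin n, (i : ℕ) < k → ∃ j, IsolatedEntry (L * M * R) i j := by
  induction k with
  | zero => exact ⟨1, 1, lowerTriInv_one, lowerTriInv_one, fun i hi => absurd hi (by omega)⟩
  | succ k ih =>
    obtain ⟨L, R, hL, hR, hiso⟩ := ih
    by_cases hk : k < n
    swap
    · exact ⟨L, R, hL, hR, fun i _ => hiso i (by omega)⟩
    let i : Fin n := ⟨k, hk⟩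
    set A := L * M * R with hA
    have hdet : IsUnit A.det := by
      rw [hA, Matrix.det_mul, Matrix.det_mul]
      exact (hL.1.mul hM).mul hR.1
    have hne : (Finset.univ.filter fun c => A i c ≠ 0).Nonempty := by
      by_contra hcon
      rw [Finset.not_nonempty_iff_eq_empty, Finset.filter_eq_empty_iff] at hcon
      exact hdet.ne_zero (Matrix.det_eq_zero_of_row_eq_zero i fun c => by
        simpa using hcon (Finset.mem_univ c))
    obtain ⟨j, hj, hmax⟩ := Finset.exists_max_image _ id hne
    have hj' : A i j ≠ 0 := (Finset.mem_filter.1 hj).2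
    obtain ⟨L', R', hL', hR', hij, hold⟩ := exists_eliminate hj'
      (fun c hc => by
        by_contra hcne
        exact absurd (hmax c (by simpa using hcne)) (not_le.2 hc))
      (fun r hr => by
        obtain ⟨s, h1, h2, h3⟩ := hiso r hr
        refine h2 j ?_
        rintro rfl
        exact hj' (h3 i hr.ne'))
    have e : L' * L * M * (R * R') = L' * A * R' := by simp only [hA, Matrix.mul_assoc]
    refine ⟨L' * L, R * R', hL'.mul hL, hR.mul hR', fun r hr => ?_⟩
    rw [e]
    rcases Nat.lt_succ_iff_lt_or_eq.1 hr with h | h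
    · obtain ⟨s, hs⟩ := hiso r h
      exact ⟨s, hold r s h hs⟩
    · obtain rfl : r = i := Fin.ext h
      exact ⟨j, hij⟩

/-- Bruhat decomposition with respect to the lower triangular Borel subgroup. -/
theorem exists_mem_doubleCosetBm {n : ℕ} {M : Mat n} (hM : IsUnit M.det) :
    ∃ w, M ∈ doubleCosetBm w := by
  obtain ⟨L, R, hL, hR, hiso⟩ := exists_isolated_rows hM n
  set A := L * M * R with hA
  choose f hf using fun i : Fin n => hiso i i.2
  have hinj : Function.Injective f := by
    intro r s hrs
    by_contra hne
    exact (hf r).1 (hrs ▸ (hf s).2.2 r hne)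
  let σ : Equiv.Perm (Fin n) := Equiv.ofBijective f (Finite.injective_iff_bijective.1 hinj)
  have hσ (i) : σ i = f i := rfl
  let D : Mat n := Matrix.diagonal fun i => A i (f i)
  have hD : lowerTriInv D := by
    refine ⟨?_, fun i j hij => Matrix.diagonal_apply_ne _ hij.ne⟩
    rw [Matrix.det_diagonal, isUnit_iff_ne_zero]
    exact Finset.prod_ne_zero_iff.2 fun i _ => (hf i).1
  have hAD : A = D * permMat σ⁻¹ := by
    ext i c
    rw [Matrix.diagonal_mul]
    by_cases hc : c = f i
    · subst hc
      simp [permMat, ← hσ]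
    · have : i ≠ σ⁻¹ c := by
        rintro rfl
        exact hc (by rw [← hσ]; simp)
      rw [(hf i).2.1 c hc, permMat, Matrix.of_apply, if_neg this, mul_zero]
  refine ⟨σ⁻¹, L⁻¹ * D, R⁻¹, hL.inv.mul hD, hR.inv, ?_⟩
  rw [Matrix.mul_assoc L⁻¹, ← hAD, hA, Matrix.mul_assoc L, Matrix.nonsing_inv_mul_cancel_left _ _ hL.1,
    Matrix.mul_nonsing_inv_cancel_right _ _ hR.1]

theorem statement9 (n : ℕ) (hn : 1 ≤ n) (u : Equiv.Perm (Fin n)) (x y : Mat n)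
    (hx : x ∈ Yge u) (hyN : upperUni y) (hyTNN : totNonneg y) :
    x * y ∈ Yge u := by
  obtain ⟨v, huv, hxN, hxTNN, hxv⟩ := hx
  have hN := hxN.mul hyN
  obtain ⟨w, hw⟩ := exists_mem_doubleCosetBm hN.isUnit_det
  refine ⟨w, huv.trans (bruhatLE_of_hasMinor fun a b k h => ?_), hN, hxTNN.mul hyTNN, hw⟩
  exact hasMinor_permMat_of_mem hw ((HasMinor.of_mem hxv h).mul_right hxTNN hyTNN hyN)

end BruhatTNN
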